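/- Let X = c₀(ℕ,ℝ), the Banach space of real sequences converging to 0 with the supremum norm. There exists a bounded, uniformly continuous function f : ℝ → X whose orbit {f_s : s ∈ ℝ} is relatively compact in the weak topology of C_b(ℝ,X) (so f is Eberlein almost periodic), but such that lim_{T→∞} (1/(2T)) ∫_{−T}^{T} ‖f(t)‖ dt does not exist; in particular f is not pseudo almost periodic, i.e. f ∉ AP(ℝ,X) + PAP_0(ℝ,X). -/

import Mathlib

open BoundedContinuousFunction Filter Topology ZeroAtInfty

/-- The translate `f_s` of `f : ℝ →ᵇ X`, defined by `f_s t = f (s + t)`. -/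
noncomputable def translateBCF {X : Type*} [SeminormedAddCommGroup X] (f : ℝ →ᵇ X) (s : ℝ) :
    ℝ →ᵇ X :=
  f.compContinuous ⟨fun t => s + t, by continuity⟩

/-- `g` is (Bohr) almost periodic: its orbit is relatively compact in the norm topology
of `C_b(ℝ,X)`. -/
def IsAP {X : Type*} [SeminormedAddCommGroup X] (g : ℝ →ᵇ X) : Prop :=
  IsCompact (closure (Set.range (translateBCF g)))


namespace EberleinNotPAP

section AlmostPeriodic

variable {X : Type*} [NormedAddCommGroup X]

lemma IsAP.exists_finset_norm_ge {g : ℝ →ᵇ X} (hg : IsAP g) (hne : g ≠ 0) :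
    ∃ c > 0, ∃ F : Finset ℝ, ∀ s, ∃ t ∈ F, c ≤ ‖g (s + t)‖ := by
  classical
  obtain ⟨t₀, ht₀⟩ : ∃ t₀, g t₀ ≠ 0 := by
    by_contra! h
    exact hne (BoundedContinuousFunction.ext h)
  have hpos : 0 < ‖g t₀‖ := norm_pos_iff.2 ht₀
  obtain ⟨F, hF⟩ := IsCompact.elim_finite_subcover hg
    (fun s => Metric.ball (translateBCF g s) (‖g t₀‖ / 2)) (fun _ => Metric.isOpen_ball) (by
      intro x hx
      obtain ⟨_, ⟨s, rfl⟩, hs⟩ := Metric.mem_closure_iff.1 hx (‖g t₀‖ / 2) (by positivity)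
      exact Set.mem_iUnion.2 ⟨s, hs⟩)
  refine ⟨‖g t₀‖ / 2, by positivity, F.image (fun s => t₀ - s), fun s => ?_⟩
  have hs := hF (subset_closure ⟨s, rfl⟩)
  simp only [Set.mem_iUnion, Metric.mem_ball] at hs
  obtain ⟨r, hr, hsr⟩ := hs
  refine ⟨t₀ - r, Finset.mem_image_of_mem _ hr, ?_⟩
  have h1 : dist (g (s + (t₀ - r))) (g (r + (t₀ - r))) < ‖g t₀‖ / 2 :=
    lt_of_le_of_lt (BoundedContinuousFunction.dist_coe_le_dist (f := translateBCF g s)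
      (g := translateBCF g r) (t₀ - r)) hsr
  rw [add_sub_cancel, dist_eq_norm] at h1
  have h2 := norm_sub_norm_le (g t₀) (g (s + (t₀ - r)))
  rw [norm_sub_rev] at h2
  linarith

lemma IsAP.eq_zero_of_norm_eq {g h : ℝ →ᵇ X} (hg : IsAP g)
    (hh : Tendsto (fun T : ℝ => (1 / (2 * T)) * ∫ t in (-T)..T, ‖h t‖) atTop (𝓝 0))
    {a : ℝ} (ha : ∀ t ≤ a, ‖g t‖ = ‖h t‖) : g = 0 := by
  by_contra hne
  obtain ⟨c, hc, F, hF⟩ := IsAP.exists_finset_norm_ge hg hne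
  have hgi : ∀ t u v : ℝ, IntervalIntegrable (fun s => ‖g (s + t)‖) MeasureTheory.volume u v :=
    fun t u v => Continuous.intervalIntegrable (by fun_prop) u v
  have hhi : ∀ u v : ℝ, IntervalIntegrable (fun s => ‖h s‖) MeasureTheory.volume u v :=
    fun u v => Continuous.intervalIntegrable (by fun_prop) u v
  obtain ⟨R, hR0, hRa, hR⟩ : ∃ R : ℝ, 0 ≤ R ∧ (∀ t ∈ F, -R + t ≤ a) ∧ ∀ t ∈ F, |t| ≤ R := by
    refine ⟨|a| + ∑ t ∈ F, |t|, by positivity, ?_, ?_⟩ <;> intro t ht <;>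
      have h1 := Finset.single_le_sum (f := fun t : ℝ => |t|) (fun i _ => abs_nonneg i) ht <;>
      have h2 := le_abs_self t <;> have h3 := neg_abs_le a <;> have h4 := abs_nonneg a <;>
      linarith
  have key : ∀ T ≥ 0, c * T ≤ F.card * ∫ t in (-(T + 2 * R))..(T + 2 * R), ‖h t‖ := by
    intro T hT
    have hle : -(T + R) ≤ -R := by linarith
    calc c * T = ∫ _ in (-(T + R))..(-R), c := by
          rw [intervalIntegral.integral_const, smul_eq_mul]; ring
      _ ≤ ∫ s in (-(T + R))..(-R), ∑ t ∈ F, ‖g (s + t)‖ := by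
          refine intervalIntegral.integral_mono_on hle (by simp)
            (Continuous.intervalIntegrable (by fun_prop) _ _) fun s _ => ?_
          obtain ⟨t, ht, hct⟩ := hF s
          exact hct.trans (Finset.single_le_sum (f := fun t => ‖g (s + t)‖)
            (fun i _ => norm_nonneg _) ht)
      _ = ∑ t ∈ F, ∫ s in (-(T + R))..(-R), ‖g (s + t)‖ :=
          intervalIntegral.integral_finsetSum fun t _ => hgi t _ _
      _ ≤ ∑ _t ∈ F, ∫ t in (-(T + 2 * R))..(T + 2 * R), ‖h t‖ := by
          refine Finset.sum_le_sum fun t ht => ?_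
          have hta := abs_le.1 (hR t ht)
          rw [intervalIntegral.integral_comp_add_right (fun s => ‖g s‖)]
          calc ∫ s in (-(T + R) + t)..(-R + t), ‖g s‖
              = ∫ s in (-(T + R) + t)..(-R + t), ‖h s‖ := by
                refine intervalIntegral.integral_congr fun s hs => ha s ?_
                rw [Set.uIcc_of_le (by linarith)] at hs
                exact hs.2.trans (hRa t ht)
            _ ≤ _ := by
                refine intervalIntegral.integral_mono_interval (by linarith) (by linarith)
                  (by linarith) (Eventually.of_forall fun s => norm_nonneg _) (hhi _ _)
      _ = _ := by rw [Finset.sum_const, nsmul_eq_mul]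
  have hlim : Tendsto (fun T : ℝ => c * (1 - 2 * R / T) - F.card *
      (2 * ((1 / (2 * T)) * ∫ t in (-T)..T, ‖h t‖))) atTop
      (𝓝 (c * (1 - 0) - F.card * (2 * 0))) :=
    (((tendsto_const_nhds.div_atTop tendsto_id).const_sub 1).const_mul c).sub
      ((hh.const_mul 2).const_mul _)
  have hle : c * (1 - 0) - F.card * (2 * 0) ≤ 0 := by
    refine le_of_tendsto hlim ?_
    filter_upwards [eventually_ge_atTop (2 * R), eventually_gt_atTop 0] with T hT hT0
    have h1 := key (T - 2 * R) (by linarith)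
    rw [sub_add_cancel] at h1
    have h2 : c * (1 - 2 * R / T) - F.card * (2 * ((1 / (2 * T)) * ∫ t in (-T)..T, ‖h t‖))
        = (c * (T - 2 * R) - F.card * ∫ t in (-T)..T, ‖h t‖) / T := by
      field_simp
    rw [h2]
    exact div_nonpos_of_nonpos_of_nonneg (by linarith) hT0.le
  linarith

lemma IsAP.eq_of_eq_add {f g h : ℝ →ᵇ X} (hg : IsAP g) (hfgh : f = g + h)
    (hh : Tendsto (fun T : ℝ => (1 / (2 * T)) * ∫ t in (-T)..T, ‖h t‖) atTop (𝓝 0))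
    {a : ℝ} (ha : ∀ t ≤ a, f t = 0) : f = h := by
  have hg0 : g = 0 := by
    refine IsAP.eq_zero_of_norm_eq hg hh (a := a) fun t ht => ?_
    have h0 : g t + h t = 0 := by
      rw [← BoundedContinuousFunction.add_apply, ← hfgh, ha t ht]
    rw [eq_neg_of_add_eq_zero_left h0, norm_neg]
  rw [hfgh, hg0, zero_add]

end AlmostPeriodic

lemma exists_separated_finset {p : ℝ → Prop} (hp : ∃ᶠ s in cocompact ℝ, p s) (d : ℝ) (N : ℕ) :
    ∃ S : Finset ℝ, S.card = N ∧ (∀ s ∈ S, p s) ∧ ∀ s ∈ S, ∀ s' ∈ S, s ≠ s' → d ≤ |s - s'| := by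
  classical
  induction N with
  | zero => exact ⟨∅, by simp⟩
  | succ N ih =>
    obtain ⟨S, hcard, hSp, hsep⟩ := ih
    have hev : ∀ᶠ s in cocompact ℝ, ∀ r ∈ S, max d 1 ≤ |s - r| := by
      rw [Filter.eventually_all_finset]
      intro r _
      exact (tendsto_dist_right_cocompact_atTop r).eventually_ge_atTop (max d 1)
    obtain ⟨s, hs, hfar⟩ := (hp.and_eventually hev).exists
    have hsS : s ∉ S := fun h => by
      have := hfar s h
      rw [sub_self, abs_zero] at this
      linarith [le_max_right d 1]
    refine ⟨insert s S, by rw [Finset.card_insert_of_notMem hsS, hcard], ?_, ?_⟩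
    · simpa using ⟨hs, hSp⟩
    · intro x hx y hy hxy
      rcases Finset.mem_insert.1 hx with rfl | hxS <;> rcases Finset.mem_insert.1 hy with rfl | hyS
      · exact absurd rfl hxy
      · exact (le_max_left d 1).trans (hfar y hyS)
      · rw [abs_sub_comm]
        exact (le_max_left d 1).trans (hfar x hxS)
      · exact hsep x hxS y hyS hxy

section Weak

variable {E : Type*} [NormedAddCommGroup E] [NormedSpace ℝ E]

/-- A family whose signed sums over `d`-separated finite sets are uniformly bounded tends weakly
to zero at infinity. -/
lemma tendsto_apply_cocompact_of_norm_sum_le {u : ℝ → E} {d C : ℝ}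
    (hu : ∀ (S : Finset ℝ) (ε : ℝ → ℝ), (∀ s ∈ S, ∀ s' ∈ S, s ≠ s' → d ≤ |s - s'|) →
      (∀ s, |ε s| ≤ 1) → ‖∑ s ∈ S, ε s • u s‖ ≤ C) (Φ : StrongDual ℝ E) :
    Tendsto (fun s => Φ (u s)) (cocompact ℝ) (𝓝 0) := by
  rw [Metric.tendsto_nhds]
  by_contra! h
  obtain ⟨c, hc, hfreq⟩ := h
  simp only [dist_zero_right, Real.norm_eq_abs] at hfreq
  obtain ⟨N, hN⟩ := exists_nat_gt (‖Φ‖ * C / c)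
  obtain ⟨S, hcard, hSc, hsep⟩ := exists_separated_finset hfreq d N
  have hle : N * c ≤ ‖Φ‖ * C :=
    calc N * c = ∑ _s ∈ S, c := by rw [Finset.sum_const, hcard, nsmul_eq_mul]
      _ ≤ ∑ s ∈ S, |Φ (u s)| := Finset.sum_le_sum hSc
      _ = Φ (∑ s ∈ S, (SignType.sign (Φ (u s)) : ℝ) • u s) := by
          rw [map_sum]
          refine Finset.sum_congr rfl fun s _ => ?_
          rw [map_smul, smul_eq_mul, sign_mul_self]
      _ ≤ ‖Φ‖ * ‖∑ s ∈ S, (SignType.sign (Φ (u s)) : ℝ) • u s‖ :=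
          (le_abs_self _).trans (Φ.le_opNorm _)
      _ ≤ ‖Φ‖ * C := by
          gcongr
          refine hu S _ hsep fun s => ?_
          rcases SignType.sign (Φ (u s)) <;> simp
  rw [div_lt_iff₀ hc] at hN
  linarith

lemma isCompact_closure_weak_range {u : ℝ → E} (hcont : Continuous u) {d C : ℝ}
    (hu : ∀ (S : Finset ℝ) (ε : ℝ → ℝ), (∀ s ∈ S, ∀ s' ∈ S, s ≠ s' → d ≤ |s - s'|) →
      (∀ s, |ε s| ≤ 1) → ‖∑ s ∈ S, ε s • u s‖ ≤ C) :
    IsCompact (closure (toWeakSpace ℝ E '' Set.range u)) := by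
  rw [← Set.range_comp]
  have hcont' : Continuous (toWeakSpace ℝ E ∘ u) := (toWeakSpaceCLM ℝ E).continuous.comp hcont
  have hlim : Tendsto (toWeakSpace ℝ E ∘ u) (cocompact ℝ) (𝓝 (toWeakSpace ℝ E 0)) := by
    refine (WeakBilin.tendsto_iff_forall_eval_tendsto (topDualPairing ℝ E).flip ?_).2 fun Φ => ?_
    · intro x y hxy
      by_contra hne
      obtain ⟨Φ, hΦ⟩ := SeparatingDual.exists_separating_of_ne (R := ℝ) hne
      exact hΦ (DFunLike.congr_fun hxy Φ)
    · have := tendsto_apply_cocompact_of_norm_sum_le hu Φ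
      rw [← map_zero Φ] at this
      exact this
  exact (hlim.isCompact_insert_range_of_cocompact hcont').closure_of_subset (Set.subset_insert _ _)

lemma isCompact_closure_weak_orbit {f : ℝ →ᵇ E} (hcont : Continuous (translateBCF f)) {d C : ℝ}
    (hf : ∀ (S : Finset ℝ) (ε : ℝ → ℝ), (∀ s ∈ S, ∀ s' ∈ S, s ≠ s' → d ≤ |s - s'|) →
      (∀ s, |ε s| ≤ 1) → ‖∑ s ∈ S, ε s • translateBCF f s‖ ≤ C) :
    IsCompact (closure (toWeakSpace ℝ (ℝ →ᵇ E) '' Set.range (translateBCF f))) :=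
  isCompact_closure_weak_range hcont hf

end Weak

/-- The triangular bump of height and radius `2` centred at the origin. -/
noncomputable def bump (x : ℝ) : ℝ := max 0 (2 - |x|)

lemma bump_nonneg (x : ℝ) : 0 ≤ bump x := le_max_left _ _

lemma bump_le_two (x : ℝ) : bump x ≤ 2 :=
  max_le (by norm_num) (by linarith [abs_nonneg x])

lemma bump_eq_zero {x : ℝ} (hx : 2 ≤ |x|) : bump x = 0 := max_eq_left (by linarith)

lemma abs_bump_sub_le (x y : ℝ) : |bump x - bump y| ≤ |x - y| := by
  have h1 : |bump x - bump y| ≤ |(2 - |x|) - (2 - |y|)| := by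
    simpa [bump, max_comm] using abs_max_sub_max_le_abs (2 - |x|) (2 - |y|) 0
  refine h1.trans ?_
  rw [sub_sub_sub_cancel_left, abs_sub_comm x y]
  exact abs_abs_sub_abs_le y x

/-- The indicator of the dyadic blocks `[2 ^ k, 2 ^ (k + 1))` with `k` even. -/
def blockWeight (n : ℕ) : ℝ := if Even (Nat.log 2 n) then 1 else 0

lemma blockWeight_nonneg (n : ℕ) : 0 ≤ blockWeight n := by
  unfold blockWeight; split_ifs <;> norm_num

lemma blockWeight_le_one (n : ℕ) : blockWeight n ≤ 1 := by
  unfold blockWeight; split_ifs <;> norm_num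

/-- The sequence of bumps at time `t`: its `n`-th coordinate is a bump centred at `t = n`,
present exactly when `n` lies in an even dyadic block. -/
noncomputable def bumpSeq (t : ℝ) : C₀(ℕ, ℝ) where
  toFun n := blockWeight n * bump (t - n)
  continuous_toFun := continuous_of_discreteTopology
  zero_at_infty' := by
    rw [Filter.cocompact_eq_cofinite, Nat.cofinite_eq_atTop]
    refine tendsto_const_nhds.congr' ?_
    filter_upwards [eventually_ge_atTop ⌈t + 2⌉₊] with n hn
    have : t + 2 ≤ n := Nat.ceil_le.1 hn
    rw [bump_eq_zero (by rw [abs_of_nonpos (by linarith)]; linarith), mul_zero]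

lemma bumpSeq_apply (t : ℝ) (n : ℕ) : bumpSeq t n = blockWeight n * bump (t - n) := rfl

lemma norm_le_of_forall {x : C₀(ℕ, ℝ)} {C : ℝ} (hC : 0 ≤ C) (h : ∀ n, |x n| ≤ C) : ‖x‖ ≤ C := by
  rw [← ZeroAtInftyContinuousMap.norm_toBCF_eq_norm]
  exact (BoundedContinuousFunction.norm_le hC).2 h

lemma abs_apply_le_norm (x : C₀(ℕ, ℝ)) (n : ℕ) : |x n| ≤ ‖x‖ := by
  rw [← ZeroAtInftyContinuousMap.norm_toBCF_eq_norm]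
  exact x.toBCF.norm_coe_le_norm n

lemma abs_bumpSeq_apply_le (t : ℝ) (n : ℕ) : |bumpSeq t n| ≤ 2 := by
  rw [bumpSeq_apply, abs_of_nonneg (mul_nonneg (blockWeight_nonneg n) (bump_nonneg _))]
  nlinarith [blockWeight_nonneg n, blockWeight_le_one n, bump_nonneg (t - n), bump_le_two (t - n)]

lemma lipschitzWith_bumpSeq : LipschitzWith 1 bumpSeq := by
  refine LipschitzWith.of_dist_le_mul fun s t => ?_
  rw [NNReal.coe_one, one_mul, dist_eq_norm, Real.dist_eq]
  refine norm_le_of_forall (abs_nonneg _) fun n => ?_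
  rw [ZeroAtInftyContinuousMap.coe_sub, Pi.sub_apply, bumpSeq_apply, bumpSeq_apply, ← mul_sub,
    abs_mul, abs_of_nonneg (blockWeight_nonneg n)]
  calc blockWeight n * |bump (s - n) - bump (t - n)| ≤ 1 * |bump (s - n) - bump (t - n)| := by
        gcongr; exact blockWeight_le_one n
    _ ≤ |(s - n) - (t - n)| := by rw [one_mul]; exact abs_bump_sub_le _ _
    _ = |s - t| := by ring_nf

lemma bumpSeq_eq_zero_of_le {t : ℝ} (ht : t ≤ -2) : bumpSeq t = 0 := by
  ext n
  have hn : (0 : ℝ) ≤ n := n.cast_nonneg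
  rw [bumpSeq_apply, bump_eq_zero (by rw [abs_of_nonpos (by linarith)]; linarith), mul_zero]
  rfl

lemma one_le_norm_bumpSeq {k : ℕ} (hk : Even k) {t : ℝ} (h1 : 2 ^ k ≤ t) (h2 : t < 2 ^ (k + 1)) :
    1 ≤ ‖bumpSeq t‖ := by
  have ht : 0 ≤ t := le_trans (by positivity) h1
  refine le_trans ?_ (abs_apply_le_norm (bumpSeq t) ⌊t⌋₊)
  have hlog : Nat.log 2 ⌊t⌋₊ = k := by
    refine Nat.log_eq_of_pow_le_of_lt_pow (Nat.le_floor (by exact_mod_cast h1)) ?_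
    rw [Nat.floor_lt ht]
    exact_mod_cast h2
  have hf1 := Nat.floor_le ht
  have hf2 := Nat.lt_floor_add_one t
  rw [bumpSeq_apply, blockWeight, hlog, if_pos hk, one_mul]
  refine le_trans (le_trans ?_ (le_max_right 0 _)) (le_abs_self _)
  rw [abs_of_nonneg (by linarith)]
  linarith

lemma bumpSeq_eq_zero_of_odd {k : ℕ} (hk : ¬ Even k) {t : ℝ} (h1 : 2 ^ k + 2 ≤ t)
    (h2 : t ≤ 2 ^ (k + 1) - 2) : bumpSeq t = 0 := by
  ext n
  rw [bumpSeq_apply]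
  change _ = (0 : ℝ)
  by_cases hn : 2 ≤ |t - n|
  · rw [bump_eq_zero hn, mul_zero]
  · obtain ⟨h3, h4⟩ := abs_lt.1 (not_le.1 hn)
    have hlog : Nat.log 2 n = k := by
      apply Nat.log_eq_of_pow_le_of_lt_pow
      · have : (2 : ℝ) ^ k ≤ n := by linarith
        exact_mod_cast this
      · have : (n : ℝ) < 2 ^ (k + 1) := by linarith
        exact_mod_cast this
    rw [blockWeight, hlog, if_neg hk, zero_mul]

/-- `bumpSeq` as a bounded continuous function. -/
noncomputable def bumpSeqBCF : ℝ →ᵇ C₀(ℕ, ℝ) :=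
  BoundedContinuousFunction.ofNormedAddCommGroup bumpSeq lipschitzWith_bumpSeq.continuous 2
    fun t => norm_le_of_forall (by norm_num) (abs_bumpSeq_apply_le t)

lemma bumpSeqBCF_apply (t : ℝ) : bumpSeqBCF t = bumpSeq t := rfl

lemma continuous_translateBCF_bumpSeqBCF : Continuous (translateBCF bumpSeqBCF) := by
  refine (LipschitzWith.of_dist_le_mul (K := 1) fun s s' => ?_).continuous
  rw [BoundedContinuousFunction.dist_le (by positivity)]
  intro t
  simpa using! lipschitzWith_bumpSeq.dist_le_mul (s + t) (s' + t)

lemma norm_sum_smul_translateBCF_le {S : Finset ℝ}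
    (hS : ∀ s ∈ S, ∀ s' ∈ S, s ≠ s' → 4 ≤ |s - s'|) {ε : ℝ → ℝ} (hε : ∀ s, |ε s| ≤ 1) :
    ‖∑ s ∈ S, ε s • translateBCF bumpSeqBCF s‖ ≤ 2 := by
  refine (BoundedContinuousFunction.norm_le (by norm_num)).2 fun t => ?_
  refine norm_le_of_forall (by norm_num) fun n => ?_
  have happ : (∑ s ∈ S, ε s • translateBCF bumpSeqBCF s) t n
      = ∑ s ∈ S, ε s * bumpSeq (s + t) n := by
    induction S using Finset.cons_induction with
    | empty => simp
    | cons a S ha ih =>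
      rw [Finset.sum_cons, Finset.sum_cons, ← ih fun s hs s' hs' => hS s
        (Finset.mem_cons_of_mem hs) s' (Finset.mem_cons_of_mem hs')]
      rfl
  rw [happ]
  by_cases h : ∃ s ∈ S, |s + t - n| < 2
  · obtain ⟨s, hs, hst⟩ := h
    rw [Finset.sum_eq_single_of_mem s hs, abs_mul]
    · nlinarith [hε s, abs_bumpSeq_apply_le (s + t) n, abs_nonneg (ε s),
        abs_nonneg (bumpSeq (s + t) n)]
    · intro s' hs' hne
      have h4 := hS s' hs' s hs hne
      have htri := abs_sub_le s' (n - t) s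
      rw [abs_sub_comm (n - t) s, show s - (n - t) = s + t - n by ring,
        show s' - (n - t) = s' + t - n by ring] at htri
      rw [bumpSeq_apply, bump_eq_zero (by linarith), mul_zero, mul_zero]
  · push Not at h
    rw [Finset.sum_eq_zero fun s hs => by
      rw [bumpSeq_apply, bump_eq_zero (h s hs), mul_zero, mul_zero]]
    norm_num

lemma isCompact_closure_orbit_bumpSeqBCF : IsCompact (closure
    ((toWeakSpace ℝ (ℝ →ᵇ C₀(ℕ, ℝ))) '' Set.range (translateBCF bumpSeqBCF))) :=
  isCompact_closure_weak_orbit continuous_translateBCF_bumpSeqBCF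
    fun _ _ hS hε => norm_sum_smul_translateBCF_le hS hε

lemma not_exists_tendsto_mean {φ : ℝ → ℝ} (hφ : Continuous φ) (hneg : ∀ t ≤ -2, φ t = 0)
    (hev : ∀ k : ℕ, Even k → ∀ t : ℝ, 2 ^ k ≤ t → t < 2 ^ (k + 1) → 1 ≤ φ t)
    (hod : ∀ k : ℕ, ¬ Even k → ∀ t : ℝ, 2 ^ k + 2 ≤ t → t ≤ 2 ^ (k + 1) - 2 → φ t = 0) :
    ¬ ∃ L : ℝ, Tendsto (fun T : ℝ => (1 / (2 * T)) * ∫ t in (-T)..T, φ t) atTop (𝓝 L) := by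
  rintro ⟨L, hL⟩
  set I : ℝ → ℝ := fun T => ∫ t in (-T)..T, φ t with hI
  have hint : ∀ u v : ℝ, IntervalIntegrable φ MeasureTheory.volume u v :=
    fun u v => hφ.intervalIntegrable u v
  have hzero : ∀ a b : ℝ, 2 ≤ a → a ≤ b → I b - I a = ∫ t in a..b, φ t := by
    intro a b ha hab
    have h1 : ∫ t in (-b)..(-a), φ t = 0 := by
      rw [← intervalIntegral.integral_zero (a := -b) (b := -a) (E := ℝ)
        (μ := MeasureTheory.volume)]
      refine intervalIntegral.integral_congr fun t ht => ?_
      rw [Set.uIcc_of_le (by linarith)] at ht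
      exact hneg t (by linarith [ht.2])
    have h2 := intervalIntegral.integral_add_adjacent_intervals (hint (-b) (-a)) (hint (-a) a)
    have h3 := intervalIntegral.integral_add_adjacent_intervals (hint (-b) a) (hint a b)
    simp only [hI]
    linarith
  have hpow : Tendsto (fun k : ℕ => (2 : ℝ) ^ k) atTop atTop :=
    tendsto_pow_atTop_atTop_of_one_lt (by norm_num)
  have hinv : ∀ c : ℝ, Tendsto (fun k : ℕ => c / (2 : ℝ) ^ k) atTop (𝓝 0) :=
    fun c => tendsto_const_nhds.div_atTop hpow
  have hup : Tendsto (fun k : ℕ => (2 : ℝ) ^ (k + 1) - 2) atTop atTop :=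
    tendsto_atTop_add_const_right _ _ (hpow.comp (tendsto_add_atTop_nat 1))
  have hlo : Tendsto (fun k : ℕ => (2 : ℝ) ^ k + 2) atTop atTop :=
    tendsto_atTop_add_const_right _ _ hpow
  have hJ : Tendsto (fun k : ℕ => (I (2 ^ (k + 1) - 2) - I (2 ^ k + 2)) / 2 ^ k) atTop
      (𝓝 (L * (4 - 0) - L * (2 + 0))) := by
    refine (((hL.comp hup).mul ((hinv 4).const_sub 4)).sub
      ((hL.comp hlo).mul ((hinv 4).const_add 2))).congr' ?_
    filter_upwards [eventually_ge_atTop 1] with k hk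
    have h2k : (2 : ℝ) ≤ 2 ^ k := by
      simpa using pow_le_pow_right₀ (one_le_two : (1 : ℝ) ≤ 2) hk
    have hne : (2 : ℝ) ^ (k + 1) - 2 ≠ 0 := by rw [pow_succ]; linarith
    have hne' : (2 : ℝ) ^ k + 2 ≠ 0 := by linarith
    simp only [Function.comp_apply]
    rw [show (4 : ℝ) - 4 / 2 ^ k = 2 * (2 ^ (k + 1) - 2) / 2 ^ k by field_simp; ring,
      show (2 : ℝ) + 4 / 2 ^ k = 2 * (2 ^ k + 2) / 2 ^ k by field_simp; ring]
    field_simp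
    rfl
  have hbig : ∀ k : ℕ, 3 ≤ k → (2 : ℝ) ≤ 2 ^ k + 2 ∧ (2 : ℝ) ^ k + 2 ≤ 2 ^ (k + 1) - 2 := by
    intro k hk
    have : (2 : ℝ) ^ 3 ≤ 2 ^ k := pow_le_pow_right₀ one_le_two hk
    rw [pow_succ]
    constructor <;> linarith
  have heven : 1 - 0 ≤ L * (4 - 0) - L * (2 + 0) := by
    have htwo : Tendsto (fun m : ℕ => 2 * m) atTop atTop :=
      tendsto_atTop_mono (fun m => show m ≤ _ by lia) tendsto_id
    refine le_of_tendsto_of_tendsto (((hinv 4).const_sub 1).comp htwo) (hJ.comp htwo) ?_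
    filter_upwards [eventually_ge_atTop 2] with m hm
    obtain ⟨h1, h2⟩ := hbig (2 * m) (by lia)
    simp only [Function.comp_apply]
    rw [hzero _ _ h1 h2, one_sub_div (by positivity)]
    gcongr
    calc (2 : ℝ) ^ (2 * m) - 4 = ∫ _ in ((2 : ℝ) ^ (2 * m) + 2)..(2 ^ (2 * m + 1) - 2), (1 : ℝ) := by
          rw [intervalIntegral.integral_const, smul_eq_mul, pow_succ]; ring
      _ ≤ _ := by
          refine intervalIntegral.integral_mono_on h2 (by simp) (hint _ _) fun t ht => ?_
          exact hev _ (even_two_mul m) t (by linarith [ht.1]) (by linarith [ht.2])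
  have hodd : L * (4 - 0) - L * (2 + 0) = 0 := by
    have htwo : Tendsto (fun m : ℕ => 2 * m + 1) atTop atTop :=
      tendsto_atTop_mono (fun m => show m ≤ _ by lia) tendsto_id
    refine tendsto_nhds_unique (hJ.comp htwo) (tendsto_const_nhds.congr' ?_)
    filter_upwards [eventually_ge_atTop 2] with m hm
    obtain ⟨h1, h2⟩ := hbig (2 * m + 1) (by lia)
    simp only [Function.comp_apply]
    rw [hzero _ _ h1 h2, intervalIntegral.integral_congr (g := fun _ => (0 : ℝ)),
      intervalIntegral.integral_zero, zero_div]
    intro t ht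
    rw [Set.uIcc_of_le h2] at ht
    exact hod (2 * m + 1) (by simp) t ht.1 ht.2
  linarith

lemma not_exists_tendsto_mean_norm_bumpSeqBCF : ¬ ∃ L : ℝ,
    Tendsto (fun T : ℝ => (1 / (2 * T)) * ∫ t in (-T)..T, ‖bumpSeqBCF t‖) atTop (𝓝 L) :=
  not_exists_tendsto_mean lipschitzWith_bumpSeq.continuous.norm
    (fun t ht => by rw [bumpSeqBCF_apply, bumpSeq_eq_zero_of_le ht, norm_zero])
    (fun _ hk _ h1 h2 => one_le_norm_bumpSeq hk h1 h2)
    (fun k hk t h1 h2 => by rw [bumpSeqBCF_apply, bumpSeq_eq_zero_of_odd hk h1 h2, norm_zero])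

end EberleinNotPAP

/-- In `X = c₀(ℕ,ℝ)` (real sequences converging to `0` with the sup norm, realized as
`C₀(ℕ,ℝ)`) there is a bounded uniformly continuous `f : ℝ → X` that is Eberlein almost
periodic, while the Bohr mean of `‖f(·)‖` does not exist; in particular `f` is not pseudo
almost periodic. -/
theorem exists_EAP_not_PAP_c0 :
    ∃ f : ℝ →ᵇ C₀(ℕ, ℝ), UniformContinuous ⇑f ∧
      IsCompact (closure ((toWeakSpace ℝ (ℝ →ᵇ C₀(ℕ, ℝ))) '' Set.range (translateBCF f))) ∧
      (¬ ∃ L : ℝ, Tendsto (fun T : ℝ => (1/(2*T)) * ∫ t in (-T)..T, ‖f t‖) atTop (𝓝 L)) ∧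
      ¬ ∃ (g h : ℝ →ᵇ C₀(ℕ, ℝ)), IsAP g ∧
          Tendsto (fun T : ℝ => (1/(2*T)) * ∫ t in (-T)..T, ‖h t‖) atTop (𝓝 0) ∧
          f = g + h := by
  open EberleinNotPAP in
  refine ⟨bumpSeqBCF, lipschitzWith_bumpSeq.uniformContinuous, isCompact_closure_orbit_bumpSeqBCF,
    not_exists_tendsto_mean_norm_bumpSeqBCF, ?_⟩
  rintro ⟨g, h, hg, hh, hsum⟩
  have hfh := IsAP.eq_of_eq_add hg hsum hh fun _ ht => bumpSeq_eq_zero_of_le ht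
  exact not_exists_tendsto_mean_norm_bumpSeqBCF ⟨0, hfh ▸ hh⟩
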